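/- arXiv:1904.02229 — 4 statements merged into one kernel-verified Lean document; each statement's English description precedes it below -/
import Mathlib

section
/- Let G be a finite simple graph and v a vertex of G of degree ρ ≥ 1. Then G is a core graph if and only if the Fowler construction F(G,v) is a core graph. -/
open Matrix

/-- Adjacency matrix of a finite simple graph over `ℚ`. -/
noncomputable def adjMat {V : Type*} [Fintype V] [DecidableEq V] (G : SimpleGraph V) :
    Matrix V V ℚ :=
  letI := Classical.decRel G.Adj
  G.adjMatrix ℚ

/-- A core graph: some kernel eigenvector of the adjacency matrix has all entries nonzero. -/
def IsCoreGraph {V : Type*} [Fintype V] [DecidableEq V] (G : SimpleGraph V) : Prop :=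
  ∃ x : V → ℚ, (adjMat G).mulVec x = 0 ∧ ∀ w, x w ≠ 0

/-- The nullity of a graph: dimension of the kernel of its adjacency matrix. -/
noncomputable def nullity {V : Type*} [Fintype V] [DecidableEq V] (G : SimpleGraph V) : ℕ :=
  Module.finrank ℚ (LinearMap.ker (adjMat G).mulVecLin)

/-- A nut graph: a core graph of nullity one. -/
def IsNutGraph {V : Type*} [Fintype V] [DecidableEq V] (G : SimpleGraph V) : Prop :=
  IsCoreGraph G ∧ nullity G = 1

/-- A graph is `ρ`-regular if every vertex has degree `ρ`. -/
def IsRegularGraph {V : Type*} (G : SimpleGraph V) (ρ : ℕ) : Prop :=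
  ∀ w, Nat.card (G.neighborSet w) = ρ

/-- The Fowler construction `F(G,v)`. -/
def Fowler {V : Type*} (G : SimpleGraph V) (v : V) :
    SimpleGraph (V ⊕ (↥(G.neighborSet v) ⊕ ↥(G.neighborSet v))) :=
  SimpleGraph.fromRel (fun a b =>
    match a, b with
    | Sum.inl w₁, Sum.inl w₂ => G.Adj w₁ w₂ ∧ w₁ ≠ v ∧ w₂ ≠ v
    | Sum.inl w, Sum.inr (Sum.inl u) => w = (u : V)
    | Sum.inl w, Sum.inr (Sum.inr _) => w = v
    | Sum.inr (Sum.inl u), Sum.inr (Sum.inr u') => (u : V) ≠ (u' : V)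
    | _, _ => False)


open scoped Classical in
theorem adjMat_mulVec_eq_zero_iff {V : Type*} [Fintype V] [DecidableEq V] (G : SimpleGraph V)
    (x : V → ℚ) :
    (adjMat G).mulVec x = 0 ↔ ∀ a, ∑ w, (if G.Adj a w then x w else 0) = 0 := by
  simp [funext_iff, adjMat, Matrix.mulVec, dotProduct, SimpleGraph.adjMatrix_apply]

namespace Fowler

variable {V : Type*} (G : SimpleGraph V) (v : V)

theorem adj_inl_inl (a b : V) :
    (Fowler G v).Adj (.inl a) (.inl b) ↔ G.Adj a b ∧ a ≠ v ∧ b ≠ v := by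
  simp only [Fowler, SimpleGraph.fromRel_adj, ne_eq, Sum.inl.injEq]
  constructor
  · rintro ⟨-, h | h⟩
    · exact h
    · exact ⟨h.1.symm, h.2.2, h.2.1⟩
  · exact fun h => ⟨h.1.ne, .inl h⟩

theorem adj_inl_p (a : V) (u : G.neighborSet v) :
    (Fowler G v).Adj (.inl a) (.inr (.inl u)) ↔ a = u := by
  simp [Fowler]

theorem adj_inl_q (a : V) (u : G.neighborSet v) :
    (Fowler G v).Adj (.inl a) (.inr (.inr u)) ↔ a = v := by
  simp [Fowler]

theorem adj_p_q (u t : G.neighborSet v) :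
    (Fowler G v).Adj (.inr (.inl u)) (.inr (.inr t)) ↔ u ≠ t := by
  simp [Fowler, Subtype.ext_iff]

theorem not_adj_p_p (u t : G.neighborSet v) :
    ¬ (Fowler G v).Adj (.inr (.inl u)) (.inr (.inl t)) := by
  simp [Fowler]

theorem not_adj_q_q (u t : G.neighborSet v) :
    ¬ (Fowler G v).Adj (.inr (.inr u)) (.inr (.inr t)) := by
  simp [Fowler]

theorem adj_p_inl (a : V) (u : G.neighborSet v) :
    (Fowler G v).Adj (.inr (.inl u)) (.inl a) ↔ a = u := by
  rw [SimpleGraph.adj_comm, adj_inl_p]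

theorem adj_q_inl (a : V) (u : G.neighborSet v) :
    (Fowler G v).Adj (.inr (.inr u)) (.inl a) ↔ a = v := by
  rw [SimpleGraph.adj_comm, adj_inl_q]

theorem adj_q_p (u t : G.neighborSet v) :
    (Fowler G v).Adj (.inr (.inr u)) (.inr (.inl t)) ↔ u ≠ t := by
  rw [SimpleGraph.adj_comm, adj_p_q, ne_comm]

theorem sum_ite_ne {ι : Type*} [Fintype ι] [DecidableEq ι] (f : ι → ℚ) (i : ι) :
    ∑ j, (if i ≠ j then f j else 0) = ∑ j, f j - f i := by
  rw [eq_sub_iff_add_eq, ← Finset.sum_filter, Finset.filter_ne,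
    Finset.sum_erase_add _ _ (Finset.mem_univ i)]

open scoped Classical in
/-- The kernel equations of the Fowler construction: at `v`, at the other vertices of `G`,
at the vertices `p_u` and at the vertices `q_u`. -/
theorem mulVec_eq_zero_iff [Fintype V] [DecidableEq V] [DecidableRel G.Adj]
    (y : V ⊕ (↥(G.neighborSet v) ⊕ ↥(G.neighborSet v)) → ℚ) :
    (adjMat (Fowler G v)).mulVec y = 0 ↔
      (∑ u, y (.inr (.inr u)) = 0) ∧
      (∀ a, a ≠ v → ∑ b, (if G.Adj a b ∧ b ≠ v then y (.inl b) else 0) +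
        (if h : a ∈ G.neighborSet v then y (.inr (.inl ⟨a, h⟩)) else 0) = 0) ∧
      (∀ u : G.neighborSet v, y (.inl u) + (∑ t, y (.inr (.inr t)) - y (.inr (.inr u))) = 0) ∧
      (∀ u : G.neighborSet v, y (.inl v) + (∑ t, y (.inr (.inl t)) - y (.inr (.inl u))) = 0) := by
  have hp : ∀ a, ∑ u : G.neighborSet v, (if a = (u : V) then y (.inr (.inl u)) else 0) =
      if h : a ∈ G.neighborSet v then y (.inr (.inl ⟨a, h⟩)) else 0 := by
    intro a
    split_ifs with h
    · rw [Finset.sum_eq_single ⟨a, h⟩]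
      · simp
      · intro u _ hu
        exact if_neg fun e => hu (Subtype.ext e.symm)
      · simp
    · refine Finset.sum_eq_zero fun u _ => if_neg ?_
      rintro rfl
      exact h u.2
  rw [adjMat_mulVec_eq_zero_iff]
  simp only [Sum.forall, Fintype.sum_sum_type, adj_inl_inl, adj_inl_p, adj_inl_q, adj_p_q,
    not_adj_p_p, not_adj_q_q, adj_p_inl, adj_q_inl, adj_q_p, sum_ite_ne, hp,
    Finset.sum_ite_eq', Finset.mem_univ, if_true, if_false, Finset.sum_const_zero,
    zero_add, add_zero]
  constructor
  · rintro ⟨h, hpq⟩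
    exact ⟨by simpa using h v, fun a ha => by simpa [ha] using h a, hpq⟩
  · rintro ⟨hv, h, hpq⟩
    refine ⟨fun a => ?_, hpq⟩
    by_cases ha : a = v
    · subst ha
      simpa using hv
    · simpa [ha] using h a ha

open scoped Classical in
theorem sum_adj_eq_add [Fintype V] [DecidableEq V] (x : V → ℚ) (a : V) :
    ∑ b, (if G.Adj a b then x b else 0) =
      ∑ b, (if G.Adj a b ∧ b ≠ v then x b else 0) + (if G.Adj v a then x v else 0) := by
  have hv : (if G.Adj v a then x v else 0) =
      ∑ b, (if b = v then (if G.Adj v a then x v else 0) else 0) := by simp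
  rw [hv, ← Finset.sum_add_distrib]
  refine Finset.sum_congr rfl fun b _ => ?_
  by_cases hb : b = v
  · subst hb
    simp [G.adj_comm]
  · simp [hb]

open scoped Classical in
theorem sum_adj_eq_sum_neighborSet [Fintype V] [Fintype (G.neighborSet v)] (x : V → ℚ) :
    ∑ b, (if G.Adj v b then x b else 0) = ∑ u : G.neighborSet v, x u := by
  rw [← Finset.sum_filter]
  exact Finset.sum_subtype _ (by simp) x

end Fowler

/-- `G` is a core graph if and only if its Fowler construction `F(G,v)` is a core graph. -/
theorem isCoreGraph_iff_fowler {V : Type*} [Fintype V] [DecidableEq V]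
    (G : SimpleGraph V) [DecidableRel G.Adj] (v : V) (rho : ℕ) (hrho : 1 ≤ rho)
    (hdeg : Nat.card (G.neighborSet v) = rho) :
    IsCoreGraph G ↔ IsCoreGraph (Fowler G v) := by
  classical
  rw [Nat.card_eq_fintype_card] at hdeg
  constructor
  · rintro ⟨x, hx, hne⟩
    rw [adjMat_mulVec_eq_zero_iff] at hx
    have hsum := hx v
    rw [Fowler.sum_adj_eq_sum_neighborSet] at hsum
    have hrho1 : rho ≠ 1 := by
      intro h1
      obtain ⟨u, hu⟩ := Fintype.card_eq_one_iff.mp (hdeg.trans h1)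
      rw [Fintype.sum_eq_single u fun t ht => absurd (hu t) ht] at hsum
      exact hne _ hsum
    refine ⟨Sum.elim (fun a => if a = v then (1 - rho) * x v else x a)
      (Sum.elim (fun _ => x v) (fun u => x u)), ?_, ?_⟩
    · rw [Fowler.mulVec_eq_zero_iff]
      refine ⟨by simpa using hsum, fun a ha => ?_, fun u => ?_, fun u => ?_⟩
      · have h := hx a
        rw [Fowler.sum_adj_eq_add G v] at h
        refine Eq.trans ?_ h
        congr 1
        · refine Finset.sum_congr rfl fun b _ => ?_
          by_cases hb : b = v <;> simp [hb]
        · simp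
      · have huv : (u : V) ≠ v := (G.ne_of_adj u.2).symm
        simp [huv, hsum]
      · simp only [Sum.elim_inl, Sum.elim_inr, if_true, Finset.sum_const, Finset.card_univ,
          hdeg, nsmul_eq_mul]
        ring
    · rintro (a | u | u)
      · by_cases ha : a = v
        · have h1 : (1 - rho : ℚ) ≠ 0 := sub_ne_zero.mpr (by exact_mod_cast hrho1.symm)
          simpa [ha] using ⟨h1, hne v⟩
        · simpa [ha] using hne a
      · exact hne v
      · exact hne u
  · rintro ⟨y, hy, hne⟩
    rw [Fowler.mulVec_eq_zero_iff] at hy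
    obtain ⟨hq, hV, hyq, hyp⟩ := hy
    have hpos : 0 < Fintype.card (G.neighborSet v) := by omega
    obtain ⟨u₀⟩ := Fintype.card_pos_iff.mp hpos
    have hp : ∀ u, y (.inr (.inl u)) = y (.inr (.inl u₀)) := fun u => by
      linarith [hyp u, hyp u₀]
    refine ⟨fun a => if a = v then y (.inr (.inl u₀)) else y (.inl a), ?_, fun a => ?_⟩
    · rw [adjMat_mulVec_eq_zero_iff]
      intro a
      by_cases ha : a = v
      · subst ha
        rw [Fowler.sum_adj_eq_sum_neighborSet]
        refine Eq.trans ?_ hq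
        refine Finset.sum_congr rfl fun u _ => ?_
        have hua : (u : V) ≠ a := (G.ne_of_adj u.2).symm
        rw [if_neg hua]
        linarith [hyq u]
      · rw [Fowler.sum_adj_eq_add G v]
        refine Eq.trans ?_ (hV a ha)
        congr 1
        · refine Finset.sum_congr rfl fun b _ => ?_
          by_cases hb : b = v <;> simp [hb]
        · simp [hp]
    · dsimp only
      split_ifs
      · exact hne _
      · exact hne _
end

section
/- Let G be a nut graph on n vertices and let v be a vertex of G of degree ρ. Then there exists a nut graph on n + 2ρ vertices. Moreover, if G is ρ-regular, then there exists a ρ-regular nut graph on n + 2ρ vertices. -/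
open Matrix

section

open Finset

open Classical in
theorem sum_neighborSet_ite_eq_const {V : Type*} [DecidableEq V] (G : SimpleGraph V) (v : V)
    [Fintype (G.neighborSet v)] (w : V) (c : ℚ) :
    (∑ u : G.neighborSet v, if w = u then c else 0) = if G.Adj w v then c else 0 := by
  split_ifs with h
  · rw [sum_eq_single ⟨w, h.symm⟩]
    · simp
    · rintro ⟨b, hb⟩ - hne
      exact if_neg fun hwb => hne (Subtype.ext hwb.symm)
    · simp
  · exact sum_eq_zero fun u _ => if_neg fun hwu => h (by rw [hwu]; exact u.2.symm)

section FowlerExtend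

variable {V : Type*} [DecidableEq V] (G : SimpleGraph V) (v : V)

/-- Kernel vectors of `G` extend to the Fowler construction. -/
noncomputable def fowlerExtend (x : V → ℚ) : V ⊕ (G.neighborSet v ⊕ G.neighborSet v) → ℚ :=
  Sum.elim (Function.update x v ((1 - ((G.neighborSet v).ncard : ℚ)) * x v))
    (Sum.elim (fun _ => x v) fun u => x u)

@[simp]
theorem fowlerExtend_inl (x : V → ℚ) (w : V) : fowlerExtend G v x (.inl w) =
    Function.update x v ((1 - ((G.neighborSet v).ncard : ℚ)) * x v) w := rfl

@[simp]
theorem fowlerExtend_inr_inl (x : V → ℚ) (u : G.neighborSet v) :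
    fowlerExtend G v x (.inr (.inl u)) = x v := rfl

@[simp]
theorem fowlerExtend_inr_inr (x : V → ℚ) (u : G.neighborSet v) :
    fowlerExtend G v x (.inr (.inr u)) = x u := rfl

end FowlerExtend

variable {V : Type*} [Fintype V] [DecidableEq V]

open Classical in
theorem adjMat_mulVec_apply (G : SimpleGraph V) (x : V → ℚ) (w : V) :
    (adjMat G *ᵥ x) w = ∑ z, if G.Adj w z then x z else 0 := by
  simp only [adjMat, mulVec, dotProduct, SimpleGraph.adjMatrix_apply, ite_mul, one_mul, zero_mul]

open Classical in
theorem natCard_neighborSet_eq_adjMat_mulVec (G : SimpleGraph V) (w : V) :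
    (Nat.card (G.neighborSet w) : ℚ) = (adjMat G *ᵥ fun _ => 1) w := by
  rw [adjMat_mulVec_apply, sum_boole, Nat.card_eq_fintype_card, Fintype.card_subtype]
  simp [SimpleGraph.mem_neighborSet]

theorem isRegularGraph_iff_adjMat_mulVec (G : SimpleGraph V) (r : ℕ) :
    IsRegularGraph G r ↔ adjMat G *ᵥ (fun _ => 1) = fun _ => (r : ℚ) := by
  simp only [IsRegularGraph, funext_iff, ← natCard_neighborSet_eq_adjMat_mulVec, Nat.cast_inj]

theorem isNutGraph_iff (G : SimpleGraph V) :
    IsNutGraph G ↔ Nonempty V ∧ ∃ x : V → ℚ, (∀ w, x w ≠ 0) ∧ adjMat G *ᵥ x = 0 ∧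
      ∀ y, adjMat G *ᵥ y = 0 → ∃ c : ℚ, c • x = y := by
  constructor
  · rintro ⟨⟨x, hx, hx0⟩, hnull⟩
    have hV : Nonempty V := by
      by_contra h
      rw [not_nonempty_iff] at h
      rw [nullity, Module.finrank_zero_of_subsingleton] at hnull
      omega
    refine ⟨hV, x, hx0, hx, fun y hy => ?_⟩
    have hxk : x ∈ LinearMap.ker (adjMat G).mulVecLin := by simpa using hx
    have hne : (⟨x, hxk⟩ : LinearMap.ker (adjMat G).mulVecLin) ≠ 0 := fun h =>
      hx0 hV.some (congrFun (congrArg Subtype.val h) hV.some)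
    obtain ⟨c, hc⟩ := (finrank_eq_one_iff_of_nonzero' _ hne).1 hnull ⟨y, by simpa using hy⟩
    exact ⟨c, congrArg Subtype.val hc⟩
  · rintro ⟨hV, x, hx0, hx, h⟩
    refine ⟨⟨x, hx, hx0⟩, ?_⟩
    have hker : LinearMap.ker (adjMat G).mulVecLin = Submodule.span ℚ {x} := by
      ext y
      rw [Submodule.mem_span_singleton, LinearMap.mem_ker, mulVecLin_apply]
      refine ⟨h y, ?_⟩
      rintro ⟨c, rfl⟩
      rw [mulVec_smul, hx, smul_zero]
    rw [nullity, hker]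
    exact finrank_span_singleton fun h0 => hx0 hV.some (congrFun h0 hV.some)

section Comap

variable {W : Type*} [Fintype W] [DecidableEq W] (e : W ≃ V) (G : SimpleGraph V)

theorem adjMat_comap_equiv_mulVec (x : V → ℚ) :
    adjMat (G.comap e) *ᵥ (x ∘ e) = (adjMat G *ᵥ x) ∘ e := by
  classical
  ext w
  simp only [adjMat_mulVec_apply, Function.comp_apply, SimpleGraph.comap_adj]
  exact Fintype.sum_equiv e _ _ fun z => rfl

theorem IsNutGraph.comap_equiv {G : SimpleGraph V} (h : IsNutGraph G) :
    IsNutGraph (G.comap e) := by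
  rw [isNutGraph_iff] at h ⊢
  obtain ⟨hV, x, hx0, hx, hker⟩ := h
  refine ⟨⟨e.symm hV.some⟩, x ∘ e, fun w => hx0 _, ?_, fun y hy => ?_⟩
  · rw [adjMat_comap_equiv_mulVec, hx]; rfl
  · have hye : y = (y ∘ e.symm) ∘ e := by ext; simp
    rw [hye, adjMat_comap_equiv_mulVec] at hy
    obtain ⟨c, hc⟩ := hker (y ∘ e.symm) (e.surjective.injective_comp_right hy)
    refine ⟨c, ?_⟩
    rw [hye, ← hc]
    rfl

theorem IsRegularGraph.comap_equiv {G : SimpleGraph V} {r : ℕ} (h : IsRegularGraph G r) :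
    IsRegularGraph (G.comap e) r := by
  rw [isRegularGraph_iff_adjMat_mulVec] at h ⊢
  exact (adjMat_comap_equiv_mulVec e G fun _ => 1).trans (by rw [h]; rfl)

end Comap

theorem adjMat_mulVec_apply_eq_sum_neighborSet (G : SimpleGraph V) (v : V)
    [Fintype (G.neighborSet v)] (x : V → ℚ) :
    (adjMat G *ᵥ x) v = ∑ u : G.neighborSet v, x u := by
  classical
  rw [adjMat_mulVec_apply, ← sum_filter]
  exact sum_subtype _ (by simp) _

open Classical in
theorem adjMat_mulVec_apply_eq_update_zero_add (G : SimpleGraph V) (v w : V) (x : V → ℚ) :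
    (adjMat G *ᵥ x) w =
      (adjMat G *ᵥ Function.update x v 0) w + if G.Adj w v then x v else 0 := by
  have h : x = Function.update x v 0 + Pi.single v (x v) := by
    ext z
    by_cases hz : z = v
    · subst hz; simp
    · simp [hz]
  conv_lhs => rw [h]
  rw [mulVec_add, Pi.add_apply, adjMat_mulVec_apply G (Pi.single v (x v))]
  congr 1
  rw [sum_eq_single v] <;> simp +contextual

section Fowler

variable (G : SimpleGraph V) (v : V) [Fintype (G.neighborSet v)]
  (y : V ⊕ (G.neighborSet v ⊕ G.neighborSet v) → ℚ)

theorem adjMat_fowler_mulVec_base :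
    (adjMat (Fowler G v) *ᵥ y) (.inl v) = ∑ u, y (.inr (.inr u)) := by
  classical
  have h (u : G.neighborSet v) : v ≠ u := G.ne_of_adj u.2
  simp [adjMat_mulVec_apply, Fowler, Fintype.sum_sum_type, h]

open Classical in
theorem adjMat_fowler_mulVec_inl {w : V} (hw : w ≠ v) :
    (adjMat (Fowler G v) *ᵥ y) (.inl w) =
      (adjMat G *ᵥ Function.update (fun z => y (.inl z)) v 0) w +
        ∑ u : G.neighborSet v, if w = u then y (.inr (.inl u)) else 0 := by
  simp only [adjMat_mulVec_apply, Fowler, Fintype.sum_sum_type, SimpleGraph.fromRel_adj]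
  simp only [ne_eq, hw, not_false_eq_true, reduceCtorEq, or_false, true_and, if_false,
    sum_const_zero, add_zero]
  congr 1
  refine sum_congr rfl fun z _ => ?_
  by_cases hz : z = v
  · simp [hz]
  · have := G.ne_of_adj (a := w) (b := z)
    by_cases h : G.Adj w z
    · simp [hz, h, h.symm, this h]
    · simp [hz, h, G.adj_comm z w]

theorem adjMat_fowler_mulVec_inr_inl (u : G.neighborSet v) :
    (adjMat (Fowler G v) *ᵥ y) (.inr (.inl u)) =
      y (.inl u) + ((∑ t, y (.inr (.inr t))) - y (.inr (.inr u))) := by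
  classical
  simp only [adjMat_mulVec_apply, Fowler, Fintype.sum_sum_type, SimpleGraph.fromRel_adj]
  rw [← sum_erase_eq_sub (mem_univ u), ← filter_ne, sum_filter]
  simp [Subtype.coe_inj, eq_comm]

theorem adjMat_fowler_mulVec_inr_inr (u : G.neighborSet v) :
    (adjMat (Fowler G v) *ᵥ y) (.inr (.inr u)) =
      y (.inl v) + ((∑ t, y (.inr (.inl t))) - y (.inr (.inl u))) := by
  classical
  simp only [adjMat_mulVec_apply, Fowler, Fintype.sum_sum_type, SimpleGraph.fromRel_adj]
  rw [← sum_erase_eq_sub (mem_univ u), ← filter_ne, sum_filter]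
  simp [Subtype.coe_inj, eq_comm]

variable {G}

theorem adjMat_fowler_mulVec_fowlerExtend {x : V → ℚ} (hx : adjMat G *ᵥ x = 0) :
    adjMat (Fowler G v) *ᵥ fowlerExtend G v x = 0 := by
  classical
  have hv : ∑ u : G.neighborSet v, x u = 0 := by
    rw [← adjMat_mulVec_apply_eq_sum_neighborSet, hx]; rfl
  have hne (u : G.neighborSet v) : (u : V) ≠ v := (G.ne_of_adj u.2).symm
  ext (w | u | u)
  · by_cases hw : w = v
    · subst hw
      simpa [adjMat_fowler_mulVec_base] using hv
    · have := congrFun hx w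
      rw [adjMat_mulVec_apply_eq_update_zero_add G v w x] at this
      rw [adjMat_fowler_mulVec_inl G v _ hw]
      simpa [sum_neighborSet_ite_eq_const] using this
  · simp [adjMat_fowler_mulVec_inr_inl, hv, hne]
  · simp [adjMat_fowler_mulVec_inr_inr]
    ring

theorem exists_fowlerExtend_eq (u₀ : G.neighborSet v)
    (hy : adjMat (Fowler G v) *ᵥ y = 0) :
    ∃ x, adjMat G *ᵥ x = 0 ∧ fowlerExtend G v x = y := by
  classical
  have hne (u : G.neighborSet v) : (u : V) ≠ v := (G.ne_of_adj u.2).symm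
  have hp : ∑ u, y (.inr (.inr u)) = 0 := by
    rw [← adjMat_fowler_mulVec_base, hy]; rfl
  have hpu (u : G.neighborSet v) : y (.inr (.inr u)) = y (.inl u) := by
    have := congrFun hy (.inr (.inl u))
    rw [adjMat_fowler_mulVec_inr_inl, hp, Pi.zero_apply] at this
    linarith
  have hq (u : G.neighborSet v) :
      y (.inr (.inl u)) = y (.inl v) + ∑ t, y (.inr (.inl t)) := by
    have := congrFun hy (.inr (.inr u))
    rw [adjMat_fowler_mulVec_inr_inr, Pi.zero_apply] at this
    linarith
  obtain ⟨c, hc⟩ : ∃ c, ∀ u, y (.inr (.inl u)) = c := ⟨_, hq⟩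
  have hyv : y (.inl v) = (1 - ((G.neighborSet v).ncard : ℚ)) * c := by
    have := hq u₀
    simp only [hc, sum_const, card_univ, Set.fintypeCard_eq_ncard, nsmul_eq_mul] at this
    linarith
  refine ⟨Function.update (fun z => y (.inl z)) v c, ?_, ?_⟩
  · ext w
    by_cases hw : w = v
    · subst hw
      simpa [adjMat_mulVec_apply_eq_sum_neighborSet, hne, hpu] using hp
    · have := congrFun hy (.inl w)
      rw [adjMat_fowler_mulVec_inl G v _ hw] at this
      simp only [hc, sum_neighborSet_ite_eq_const] at this
      rw [adjMat_mulVec_apply_eq_update_zero_add G v]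
      simpa using this
  · ext (w | u | u)
    · by_cases hw : w = v
      · subst hw; simp [hyv]
      · simp [hw]
    · simp [hc]
    · simp [hne, hpu]

theorem IsNutGraph.fowler (h : IsNutGraph G) (hv : (G.neighborSet v).Nonempty) :
    IsNutGraph (Fowler G v) := by
  rw [isNutGraph_iff] at h ⊢
  obtain ⟨-, x, hx0, hx, hker⟩ := h
  obtain ⟨u, hu⟩ := hv
  have hcard : (1 - ((G.neighborSet v).ncard : ℚ)) ≠ 0 := by
    intro hc
    have hone : Fintype.card (G.neighborSet v) = 1 := by
      rw [Set.fintypeCard_eq_ncard]; exact_mod_cast (sub_eq_zero.1 hc).symm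
    obtain ⟨t, ht⟩ := Fintype.card_eq_one_iff.1 hone
    have hsum := congrFun hx v
    rw [adjMat_mulVec_apply_eq_sum_neighborSet, sum_eq_single t (fun b _ hb => (hb (ht b)).elim)
      (by simp)] at hsum
    exact hx0 _ hsum
  refine ⟨⟨.inl v⟩, fowlerExtend G v x, ?_, adjMat_fowler_mulVec_fowlerExtend v hx, fun y hy => ?_⟩
  · rintro (w | u | u)
    · by_cases hw : w = v
      · subst hw; simpa [hx0] using hcard
      · simp [hw, hx0]
    · exact hx0 _
    · exact hx0 _
  · obtain ⟨z, hz, rfl⟩ := exists_fowlerExtend_eq v y ⟨u, hu⟩ hy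
    obtain ⟨c, rfl⟩ := hker z hz
    refine ⟨c, ?_⟩
    ext (w | u | u)
    · by_cases hw : w = v
      · subst hw; simp; ring
      · simp [hw]
    · rfl
    · rfl

theorem IsRegularGraph.fowler {r : ℕ} (h : IsRegularGraph G r) :
    IsRegularGraph (Fowler G v) r := by
  classical
  have hcard : ((G.neighborSet v).ncard : ℚ) = r := by
    exact_mod_cast h v
  rw [isRegularGraph_iff_adjMat_mulVec] at h ⊢
  ext (w | u | u)
  · by_cases hw : w = v
    · subst hw; simpa [adjMat_fowler_mulVec_base] using hcard
    · rw [adjMat_fowler_mulVec_inl G v _ hw, sum_neighborSet_ite_eq_const,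
        ← adjMat_mulVec_apply_eq_update_zero_add G v w (fun _ => 1), h]
  · simp [adjMat_fowler_mulVec_inr_inl, hcard]
  · simp [adjMat_fowler_mulVec_inr_inr, hcard]

end Fowler

end

/-- If `G` is a nut graph on `n` vertices with a vertex `v` of degree `ρ`, then there
exists a nut graph on `n + 2ρ` vertices; moreover if `G` is `ρ`-regular then there
exists a `ρ`-regular nut graph on `n + 2ρ` vertices. -/
theorem exists_nut_graph_add_two_mul_degree {V : Type*} [Fintype V] [DecidableEq V]
    (G : SimpleGraph V) (n rho : ℕ) (hn : Fintype.card V = n)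
    (v : V) (hdeg : Nat.card (G.neighborSet v) = rho)
    (hnut : IsNutGraph G) :
    (∃ H : SimpleGraph (Fin (n + 2 * rho)), IsNutGraph H) ∧
      (IsRegularGraph G rho →
        ∃ H : SimpleGraph (Fin (n + 2 * rho)), IsNutGraph H ∧ IsRegularGraph H rho) := by
  classical
  rcases (G.neighborSet v).eq_empty_or_nonempty with hv | hv
  · obtain rfl : rho = 0 := by rw [← hdeg, hv]; simp
    let e : Fin (n + 2 * 0) ≃ V := (Fintype.equivFinOfCardEq hn).symm
    exact ⟨⟨_, hnut.comap_equiv e⟩, fun hreg => ⟨_, hnut.comap_equiv e, hreg.comap_equiv e⟩⟩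
  · have hcard : Fintype.card (V ⊕ (G.neighborSet v ⊕ G.neighborSet v)) = n + 2 * rho := by
      rw [Fintype.card_sum, Fintype.card_sum, hn, ← Nat.card_eq_fintype_card, hdeg, two_mul]
    let e := (Fintype.equivFinOfCardEq hcard).symm
    have hF := (hnut.fowler v hv).comap_equiv e
    exact ⟨⟨_, hF⟩, fun hreg => ⟨_, hF, (hreg.fowler v).comap_equiv e⟩⟩
end

section
/- For every integer n ≥ 3, the quartic antiprism graph A_n on 2n vertices is a nut graph if and only if n is not divisible by 3. -/
open Matrix

/-- The antiprism graph `A_n`, i.e. the circulant graph `Ci_{2n}(1,2)` on `ℤ/2nℤ`: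
`i` and `j` adjacent iff `i - j ≡ ±1, ±2 (mod 2n)`. -/
def antiprism (n : ℕ) : SimpleGraph (ZMod (2 * n)) :=
  SimpleGraph.fromRel (fun i j => i - j = 1 ∨ i - j = 2)

lemma sum_add_sub_one_two {R M : Type*} [CommRing R] [DecidableEq R] [AddCommMonoid M]
    (h1 : (1 : R) ≠ 0) (h2 : (2 : R) ≠ 0) (h3 : (3 : R) ≠ 0) (h4 : (4 : R) ≠ 0)
    (f : R → M) (i : R) :
    ∑ j ∈ ({i + 1, i + 2, i - 1, i - 2} : Finset R), f j =
      f (i + 1) + f (i + 2) + f (i - 1) + f (i - 2) := by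
  rw [Finset.sum_insert, Finset.sum_insert, Finset.sum_insert, Finset.sum_singleton]
  · abel
  · rw [Finset.mem_singleton]
    exact fun h => h1 (by linear_combination h)
  · simp only [Finset.mem_insert, Finset.mem_singleton]
    rintro (h | h)
    · exact h3 (by linear_combination h)
    · exact h4 (by linear_combination h)
  · simp only [Finset.mem_insert, Finset.mem_singleton]
    rintro (h | h | h)
    · exact h1 (by linear_combination -h)
    · exact h2 (by linear_combination h)
    · exact h3 (by linear_combination h)

lemma ne_and_sub_eq_one_or_two_iff {R : Type*} [CommRing R]
    (h1 : (1 : R) ≠ 0) (h2 : (2 : R) ≠ 0) (i j : R) :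
    (i ≠ j ∧ ((i - j = 1 ∨ i - j = 2) ∨ (j - i = 1 ∨ j - i = 2))) ↔
      j = i + 1 ∨ j = i + 2 ∨ j = i - 1 ∨ j = i - 2 := by
  grind

/-- Each vertex of `A_n` has exactly the four neighbours `i ± 1`, `i ± 2`. -/
lemma adjMat_antiprism_mulVec (n : ℕ) [NeZero n] (hn : 3 ≤ n) (x : ZMod (2 * n) → ℚ)
    (i : ZMod (2 * n)) :
    (adjMat (antiprism n)).mulVec x i = x (i + 1) + x (i + 2) + x (i - 1) + x (i - 2) := by
  classical
  have ne_zero (k : ℕ) (hk : 0 < k) (hk' : k < 6) : (k : ZMod (2 * n)) ≠ 0 := by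
    rw [Ne, ZMod.natCast_eq_zero_iff]
    intro h
    have := Nat.le_of_dvd hk h
    omega
  have h1 := ne_zero 1 (by norm_num) (by norm_num)
  have h2 := ne_zero 2 (by norm_num) (by norm_num)
  have h3 := ne_zero 3 (by norm_num) (by norm_num)
  have h4 := ne_zero 4 (by norm_num) (by norm_num)
  push_cast at h1 h2 h3 h4
  have hnbr : (antiprism n).neighborFinset i = {i + 1, i + 2, i - 1, i - 2} := by
    ext j
    rw [SimpleGraph.mem_neighborFinset]
    simp only [antiprism, SimpleGraph.fromRel_adj, Finset.mem_insert, Finset.mem_singleton]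
    exact ne_and_sub_eq_one_or_two_iff h1 h2 i j
  have hsum : (adjMat (antiprism n)).mulVec x i
      = ∑ j ∈ (antiprism n).neighborFinset i, x j := by
    unfold adjMat
    convert SimpleGraph.adjMatrix_mulVec_apply (G := antiprism n) i x
  rw [hsum, hnbr, sum_add_sub_one_two h1 h2 h3 h4]

lemma mem_ker_adjMat_antiprism_iff (n : ℕ) [NeZero n] (hn : 3 ≤ n) (x : ZMod (2 * n) → ℚ) :
    x ∈ LinearMap.ker (adjMat (antiprism n)).mulVecLin ↔
      ∀ i, x (i + 1) + x (i + 2) + x (i - 1) + x (i - 2) = 0 := by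
  rw [LinearMap.mem_ker, Matrix.mulVecLin_apply, funext_iff]
  simp only [adjMat_antiprism_mulVec n hn, Pi.zero_apply]

/-- The vector with entries `1` at even and `-1` at odd residues. -/
def alternating (n : ℕ) (i : ZMod (2 * n)) : ℚ :=
  if ZMod.castHom (dvd_mul_right 2 n) (ZMod 2) i = 0 then 1 else -1

lemma alternating_ne_zero (n : ℕ) (i : ZMod (2 * n)) : alternating n i ≠ 0 := by
  unfold alternating
  split_ifs <;> norm_num

lemma alternating_zero (n : ℕ) : alternating n 0 = 1 := by
  simp [alternating]

lemma alternating_add_one (n : ℕ) (i : ZMod (2 * n)) :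
    alternating n (i + 1) = -alternating n i := by
  unfold alternating
  rw [map_add, map_one]
  generalize ZMod.castHom (dvd_mul_right 2 n) (ZMod 2) i = a
  revert a
  decide

lemma alternating_mem_ker (n : ℕ) [NeZero n] (hn : 3 ≤ n) :
    alternating n ∈ LinearMap.ker (adjMat (antiprism n)).mulVecLin := by
  rw [mem_ker_adjMat_antiprism_iff n hn]
  intro i
  have h1 := alternating_add_one n (i - 2)
  have h2 := alternating_add_one n (i - 1)
  have h3 := alternating_add_one n i
  have h4 := alternating_add_one n (i + 1)
  ring_nf at *
  linarith

/-- A kernel vector of period `6`, not proportional to the alternating one. -/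
lemma exists_mem_ker_of_three_dvd (n : ℕ) [NeZero n] (hn : 3 ≤ n) (h : 3 ∣ n) :
    ∃ x ∈ LinearMap.ker (adjMat (antiprism n)).mulVecLin, x 0 = 1 ∧ x 1 = 1 := by
  let p : ZMod 6 → ℤ := ![1, 1, 0, -1, -1, 0]
  let f := ZMod.castHom (mul_dvd_mul_left 2 h : 2 * 3 ∣ 2 * n) (ZMod 6)
  refine ⟨fun i => (p (f i) : ℚ), ?_, ?_, ?_⟩
  · rw [mem_ker_adjMat_antiprism_iff n hn]
    intro i
    have hp : ∀ a : ZMod 6, p (a + 1) + p (a + 2) + p (a - 1) + p (a - 2) = 0 := by decide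
    have := hp (f i)
    simp only [map_add, map_sub, map_one, map_ofNat]
    exact_mod_cast this
  · simp [p]
  · simp [p]

/-- A sequence on `ℤ/2nℤ` with `3 ∤ n` and antiperiod `3` has period `2`. -/
lemma add_two_eq_of_add_three_eq_neg (n : ℕ) (h : ¬ 3 ∣ n) (y : ZMod (2 * n) → ℚ)
    (hy : ∀ i, y (i + 3) = -y i) (i : ZMod (2 * n)) : y (i + 2) = y i := by
  have h6 : Function.Periodic y 6 := fun j => by
    have h1 := hy (j + 3)
    rw [hy j, neg_neg, add_assoc] at h1
    norm_num at h1
    exact h1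
  have h0 : ((2 * n : ℕ) : ZMod (2 * n)) = 0 := ZMod.natCast_self _
  push_cast at h0
  have hmod : n % 3 = 1 ∨ n % 3 = 2 := by omega
  rcases hmod with hm | hm
  · obtain ⟨k, rfl⟩ : ∃ k, n = 3 * k + 1 := ⟨n / 3, by omega⟩
    have h2 := h6.nat_mul k (i + 2)
    rw [← h2]
    congr 1
    push_cast at h0 ⊢
    linear_combination h0
  · obtain ⟨k, rfl⟩ : ∃ k, n = 3 * k + 2 := ⟨n / 3, by omega⟩
    have h2 := h6.nat_mul (k + 1) i
    rw [← h2]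
    congr 1
    push_cast at h0 ⊢
    linear_combination -h0

lemma add_one_eq_neg_of_mem_ker (n : ℕ) [NeZero n] (hn : 3 ≤ n) (h : ¬ 3 ∣ n)
    (x : ZMod (2 * n) → ℚ) (hx : x ∈ LinearMap.ker (adjMat (antiprism n)).mulVecLin)
    (i : ZMod (2 * n)) : x (i + 1) = -x i := by
  rw [mem_ker_adjMat_antiprism_iff n hn] at hx
  let y : ZMod (2 * n) → ℚ := fun i => x i + x (i + 1)
  have hy3 : ∀ j, y (j + 3) = -y j := fun j => by
    have := hx (j + 2)
    simp only [y]
    ring_nf at this ⊢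
    linarith
  have hy2 := add_two_eq_of_add_three_eq_neg n h y hy3
  have hy1 : ∀ j, y (j + 1) = -y j := fun j => by
    rw [← hy3 j, ← hy2 (j + 1)]
    ring_nf
  have hstep : ∀ k : ℕ, x (i + 2 * k) = x i - 2 * k * y i ∧ y (i + 2 * k) = y i := by
    intro k
    induction k with
    | zero => simp
    | succ k ih =>
      have e : i + 2 * ((k + 1 : ℕ) : ZMod (2 * n)) = i + 2 * k + 2 := by push_cast; ring
      have e' : i + 2 * (k : ZMod (2 * n)) + 1 + 1 = i + 2 * k + 2 := by ring
      rw [e, hy2, ih.2]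
      refine ⟨?_, rfl⟩
      have h1 := hy1 (i + 2 * k)
      have h2 := ih.2
      simp only [y, e'] at h1 h2 ⊢
      push_cast
      linarith [ih.1]
  have h0 : ((2 * n : ℕ) : ZMod (2 * n)) = 0 := ZMod.natCast_self _
  push_cast at h0
  have h1 := (hstep n).1
  rw [h0, add_zero] at h1
  have hn0 : (2 * n : ℚ) ≠ 0 := by exact_mod_cast NeZero.ne (2 * n)
  have hyi : y i = 0 := by
    refine (mul_eq_zero.mp ?_).resolve_left hn0
    linarith
  simp only [y] at hyi
  linarith

lemma eq_smul_alternating (n : ℕ) [NeZero n] (x : ZMod (2 * n) → ℚ)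
    (hx : ∀ i, x (i + 1) = -x i) : x 0 • alternating n = x := by
  have hnat : ∀ k : ℕ, x k = x 0 * alternating n k := by
    intro k
    induction k with
    | zero => simp [alternating_zero]
    | succ k ih =>
      push_cast
      rw [hx, alternating_add_one, ih, mul_neg]
  funext i
  rw [Pi.smul_apply, smul_eq_mul, ← ZMod.natCast_zmod_val i, ← hnat]

/-- For `n ≥ 3`, the antiprism `A_n` is a nut graph iff `3 ∤ n`. -/
theorem antiprism_isNutGraph_iff (n : ℕ) [NeZero n] (hn : 3 ≤ n) :
    IsNutGraph (antiprism n) ↔ ¬ (3 ∣ n) := by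
  have hcore : IsCoreGraph (antiprism n) :=
    ⟨alternating n, alternating_mem_ker n hn, alternating_ne_zero n⟩
  let v : LinearMap.ker (adjMat (antiprism n)).mulVecLin :=
    ⟨alternating n, alternating_mem_ker n hn⟩
  have hv : v ≠ 0 := fun h =>
    alternating_ne_zero n 0 (congrFun (congrArg Subtype.val h) 0)
  rw [IsNutGraph, and_iff_right hcore, nullity, finrank_eq_one_iff_of_nonzero' v hv]
  constructor
  · intro hspan h3
    obtain ⟨x, hx, hx0, hx1⟩ := exists_mem_ker_of_three_dvd n hn h3
    obtain ⟨c, hc⟩ := hspan ⟨x, hx⟩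
    have hc' : c • alternating n = x := congrArg Subtype.val hc
    have h0 := congrFun hc' 0
    have h1 := congrFun hc' (0 + 1)
    rw [Pi.smul_apply, smul_eq_mul] at h0 h1
    rw [alternating_add_one, zero_add, hx1] at h1
    rw [hx0] at h0
    linarith
  · rintro h3 ⟨x, hx⟩
    exact ⟨x 0, Subtype.ext (eq_smul_alternating n x (add_one_eq_neg_of_mem_ker n hn h3 x hx))⟩
end

section
/- Let n ≥ 3 be an integer divisible by 3. For k ∈ {0, 1, 2}, define the vector v_k on ℤ/2nℤ by v_k(i) = −1 if i ≡ 2−k (mod 6), v_k(i) = 1 if i ≡ 5−k (mod 6), and v_k(i) = 0 otherwise. Then v_0, v_1, v_2 are three linearly independent vectors in the kernel of the adjacency matrix of the antiprism graph A_n = Ci_{2n}(1,2); in particular η(A_n) ≥ 3 and A_n is not a nut graph. -/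
open Matrix

/-- The vector `v_k` on `ℤ/2nℤ`: value `-1` on residues `≡ 2-k (mod 6)`, value `1`
on residues `≡ 5-k (mod 6)`, and `0` elsewhere. -/
def antiprismKerVec (n k : ℕ) : ZMod (2 * n) → ℚ := fun i =>
  if i.val % 6 = (2 - k) % 6 then -1
  else if i.val % 6 = (5 - k) % 6 then 1
  else 0

/-- Numerals strictly between `0` and `m` do not vanish in `ZMod m`. -/
lemma ZMod.natCast_ne_zero_of_pos_of_lt {m a : ℕ} (ha : 0 < a) (ham : a < m) :
    (a : ZMod m) ≠ 0 := by
  rw [Ne, ZMod.natCast_eq_zero_iff]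
  exact Nat.not_dvd_of_pos_of_lt ha ham

/-- The adjacency operator of the antiprism sums over the four neighbours of a vertex. -/
lemma adjMat_antiprism_mulVec_apply (n : ℕ) [NeZero n] (hn : 3 ≤ n) (x : ZMod (2 * n) → ℚ)
    (i : ZMod (2 * n)) :
    (adjMat (antiprism n)).mulVec x i = x (i - 1) + x (i + 1) + x (i - 2) + x (i + 2) := by
  classical
  have h1 : (1 : ZMod (2 * n)) ≠ 0 := by
    exact_mod_cast ZMod.natCast_ne_zero_of_pos_of_lt (m := 2 * n) (a := 1) (by lia) (by lia)
  have h2 : (2 : ZMod (2 * n)) ≠ 0 := by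
    exact_mod_cast ZMod.natCast_ne_zero_of_pos_of_lt (m := 2 * n) (a := 2) (by lia) (by lia)
  have h3 : (3 : ZMod (2 * n)) ≠ 0 := by
    exact_mod_cast ZMod.natCast_ne_zero_of_pos_of_lt (m := 2 * n) (a := 3) (by lia) (by lia)
  have h4 : (4 : ZMod (2 * n)) ≠ 0 := by
    exact_mod_cast ZMod.natCast_ne_zero_of_pos_of_lt (m := 2 * n) (a := 4) (by lia) (by lia)
  have hadj : ∀ j, (antiprism n).Adj i j ↔
      j ∈ ({i - 1, i + 1, i - 2, i + 2} : Finset (ZMod (2 * n))) := by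
    intro j
    simp only [antiprism, SimpleGraph.fromRel_adj, Finset.mem_insert, Finset.mem_singleton]
    grind
  have hsum : (adjMat (antiprism n)).mulVec x i =
      ∑ j ∈ ({i - 1, i + 1, i - 2, i + 2} : Finset (ZMod (2 * n))), x j := by
    simp only [Matrix.mulVec, dotProduct, adjMat, SimpleGraph.adjMatrix_apply, hadj, ite_mul,
      one_mul, zero_mul, Finset.sum_ite_mem, Finset.univ_inter]
  rw [hsum, Finset.sum_insert, Finset.sum_insert, Finset.sum_insert, Finset.sum_singleton]
  · ring
  · simp only [Finset.mem_singleton]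
    exact fun h => h4 (by linear_combination -h)
  · simp only [Finset.mem_insert, Finset.mem_singleton]
    rintro (h | h)
    · exact h3 (by linear_combination h)
    · exact h1 (by linear_combination -h)
  · simp only [Finset.mem_insert, Finset.mem_singleton]
    rintro (h | h | h)
    · exact h2 (by linear_combination -h)
    · exact h1 (by linear_combination h)
    · exact h3 (by linear_combination -h)

/-- For `3 ∣ n`, the vector `v_k` factors through the reduction `ℤ/2nℤ → ℤ/6ℤ`. -/
lemma antiprismKerVec_eq_castHom (n : ℕ) [NeZero n] (h : 2 * 3 ∣ 2 * n) (k : Fin 3)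
    (i : ZMod (2 * n)) :
    antiprismKerVec n k i = antiprismKerVec 3 k (ZMod.castHom h (ZMod (2 * 3)) i) := by
  have hval : (ZMod.castHom h (ZMod (2 * 3)) i).val = i.val % 6 := by
    rw [ZMod.castHom_apply, ZMod.cast_eq_val, ZMod.val_natCast]
  simp only [antiprismKerVec, hval, Nat.mod_mod]

/-- On `ℤ/6ℤ` the vector `v_k` sums to zero over the offsets `±1, ±2`. -/
lemma antiprismKerVec_three_sum_neighbors (k : Fin 3) (a : ZMod (2 * 3)) :
    antiprismKerVec 3 k (a - 1) + antiprismKerVec 3 k (a + 1) + antiprismKerVec 3 k (a - 2) +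
      antiprismKerVec 3 k (a + 2) = 0 := by
  unfold antiprismKerVec
  revert k a
  decide +kernel

lemma antiprism_mulVec_antiprismKerVec (n : ℕ) [NeZero n] (hn : 3 ≤ n) (h3 : 3 ∣ n)
    (k : Fin 3) : (adjMat (antiprism n)).mulVec (antiprismKerVec n k) = 0 := by
  have h : 2 * 3 ∣ 2 * n := mul_dvd_mul_left 2 h3
  ext i
  rw [adjMat_antiprism_mulVec_apply n hn]
  simp only [antiprismKerVec_eq_castHom n h, map_sub, map_add, map_one, map_ofNat]
  exact antiprismKerVec_three_sum_neighbors k _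

/-- Evaluating `v_k` at `0, 1, 2` gives minus a permuted identity matrix. -/
lemma antiprismKerVec_natCast (n : ℕ) (hn : 3 ≤ n) (j k : Fin 3) :
    antiprismKerVec n k ((2 - j : ℕ) : ZMod (2 * n)) = if k = j then -1 else 0 := by
  rw [antiprismKerVec, ZMod.val_natCast_of_lt (by lia)]
  revert j k
  decide +kernel

lemma linearIndependent_antiprismKerVec (n : ℕ) (hn : 3 ≤ n) :
    LinearIndependent ℚ (fun k : Fin 3 => antiprismKerVec n (k : ℕ)) := by
  rw [Fintype.linearIndependent_iff]
  intro g hg j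
  simpa [Finset.sum_apply, antiprismKerVec_natCast n hn] using
    congrFun hg ((2 - j : ℕ) : ZMod (2 * n))

/-- For `3 ∣ n`, the vectors `v₀, v₁, v₂` are three linearly independent kernel
vectors of the antiprism `A_n`; hence `η(A_n) ≥ 3` and `A_n` is not a nut graph. -/
theorem antiprism_three_kernel_vectors (n : ℕ) [NeZero n] (hn : 3 ≤ n) (h3 : 3 ∣ n) :
    (∀ k : Fin 3, (adjMat (antiprism n)).mulVec (antiprismKerVec n k) = 0) ∧
      LinearIndependent ℚ (fun k : Fin 3 => antiprismKerVec n (k : ℕ)) ∧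
      3 ≤ nullity (antiprism n) ∧ ¬ IsNutGraph (antiprism n) := by
  have hker := antiprism_mulVec_antiprismKerVec n hn h3
  have hli := linearIndependent_antiprismKerVec n hn
  have hnull : 3 ≤ nullity (antiprism n) := by
    have hspan : Submodule.span ℚ (Set.range fun k : Fin 3 => antiprismKerVec n (k : ℕ)) ≤
        LinearMap.ker (adjMat (antiprism n)).mulVecLin := by
      rw [Submodule.span_le]
      rintro _ ⟨k, rfl⟩
      exact hker k
    simpa [nullity, finrank_span_eq_card hli] using Submodule.finrank_mono hspan
  exact ⟨hker, hli, hnull, fun h => by have := h.2; lia⟩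
end
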